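/- arXiv:2406.00823 — 2 statements merged into one kernel-verified Lean document; each statement's English description precedes it below -/
import Mathlib

section
/- Let (x_t)_{t≥1} be a sequence of random vectors in ℝ^d adapted to a filtration (F_t)_{t≥0} with ‖x_t‖∞ ≤ x_max almost surely for all t, and let S₀ ⊆ {1,…,d} with s₀ = |S₀|. Let V̂_t = Σ_{i=1}^t x_i x_iᵀ and V̄_t = Σ_{i=1}^t E[x_i x_iᵀ | F_{i−1}]. Suppose there is φ₀ > 0 such that almost surely φ²(V̄_t, S₀) ≥ φ₀²·t for all t ≥ 1. Then for any δ ∈ (0,1], with probability at least 1 − δ, φ²(V̂_t, S₀) ≥ φ₀²·t/2 holds simultaneously for all t ≥ (2048·x_max⁴·s₀²/φ₀⁴)·(log(d²/δ) + 2·log(64·x_max²·s₀/φ₀²)) + 1. -/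
set_option autoImplicit false

open MeasureTheory ProbabilityTheory Matrix Finset
open scoped Classical ENNReal

noncomputable section

namespace Paper

section Compat

variable {ι : Type*} [Fintype ι] [DecidableEq ι]

/-- The ℓ¹ norm of a vector. -/
def l1 (v : ι → ℝ) : ℝ := ∑ j, |v j|

/-- The restriction of a vector to an index set. -/
def restr (S : Finset ι) (v : ι → ℝ) : ι → ℝ := fun j => if j ∈ S then v j else 0

/-- The compatibility constant `φ²(M, S)`. -/
def compat (M : Matrix ι ι ℝ) (S : Finset ι) : ℝ :=
  sInf {c : ℝ | ∃ v : ι → ℝ, l1 (restr Sᶜ v) ≤ 3 * l1 (restr S v) ∧ restr S v ≠ 0 ∧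
    c = (S.card : ℝ) * (v ⬝ᵥ (M *ᵥ v)) / l1 (restr S v) ^ 2}

/-- The expected Gram matrix `E[x xᵀ]` of a random vector. -/
def gram {Ω : Type*} [MeasurableSpace Ω] (P : Measure Ω) (x : Ω → ι → ℝ) : Matrix ι ι ℝ :=
  Matrix.of fun i j => ∫ ω, x ω i * x ω j ∂P

/-- The conditional Gram matrix `E[x xᵀ | A]`. -/
def condGram {Ω : Type*} [MeasurableSpace Ω] (P : Measure Ω) (A : Set Ω) (x : Ω → ι → ℝ) :
    Matrix ι ι ℝ :=
  Matrix.of fun i j => (∫ ω in A, x ω i * x ω j ∂P) / (P A).toReal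

end Compat

section Helpers

lemma two_point (m u : ℝ) (hm : |m| ≤ 1) :
    Real.cosh u + m * Real.sinh u ≤ Real.exp (u * m + u ^ 2 / 2) := by
  obtain ⟨h1, h2⟩ := abs_le.mp hm
  have hp : 0 ≤ (1 + m) / 2 := by linarith
  have hq : 0 ≤ (1 - m) / 2 := by linarith
  let μ : Measure ℝ := ENNReal.ofReal ((1 + m) / 2) • Measure.dirac 1 +
    ENNReal.ofReal ((1 - m) / 2) • Measure.dirac (-1)
  have hprob : IsProbabilityMeasure μ := by
    constructor
    simp only [μ, Measure.add_apply, Measure.smul_apply, measure_univ, smul_eq_mul, mul_one]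
    rw [← ENNReal.ofReal_add hp hq]
    norm_num [← add_div]
  have hint : ∀ f : ℝ → ℝ, ∫ y, f y ∂μ = (1 + m) / 2 * f 1 + (1 - m) / 2 * f (-1) := by
    intro f
    have hi : ∀ (a c : ℝ), Integrable f (ENNReal.ofReal c • Measure.dirac a) := fun a c =>
      (integrable_dirac (by finiteness)).smul_measure ENNReal.ofReal_ne_top
    simp only [μ]
    rw [integral_add_measure (hi _ _) (hi _ _), integral_smul_measure, integral_smul_measure,
      integral_dirac, integral_dirac, ENNReal.toReal_ofReal hp, ENNReal.toReal_ofReal hq]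
    simp
  have hE : ∫ y, id y ∂μ = m := by
    rw [hint]; simp; ring
  have hae : ∀ᵐ y ∂μ, id y ∈ Set.Icc (-1 : ℝ) 1 := by
    rw [ae_iff]
    have : {a : ℝ | ¬ id a ∈ Set.Icc (-1 : ℝ) 1} = (Set.Icc (-1 : ℝ) 1)ᶜ := rfl
    rw [this]
    simp [μ]
  have key := (hasSubgaussianMGF_of_mem_Icc (μ := μ) (X := id) aemeasurable_id hae).mgf_le u
  rw [mgf, hint, hE] at key
  have hc : (((‖(1:ℝ) - -1‖₊ / 2) ^ 2 : NNReal) : ℝ) = 1 := by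
    push_cast
    norm_num
  rw [hc] at key
  have e1 : Real.exp (u * m + u ^ 2 / 2) = Real.exp (u * m) * Real.exp (1 * u ^ 2 / 2) := by
    rw [← Real.exp_add]; ring_nf
  rw [e1]
  refine le_trans (le_of_eq ?_) (mul_le_mul_of_nonneg_left key (Real.exp_pos _).le)
  have e2 : Real.exp (u * (id 1 - m)) = Real.exp u * Real.exp (-(u * m)) := by
    rw [← Real.exp_add]; simp; ring
  have e3 : Real.exp (u * (id (-1) - m)) = Real.exp (-u) * Real.exp (-(u * m)) := by
    rw [← Real.exp_add]; simp; ring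
  have e4 : Real.exp (u * m) * Real.exp (-(u * m)) = 1 := by
    rw [← Real.exp_add]; simp
  rw [e2, e3, Real.cosh_eq, Real.sinh_eq]
  linear_combination (-((1 + m) / 2 * Real.exp u + (1 - m) / 2 * Real.exp (-u))) * e4

lemma exp_chord (y l b : ℝ) (hb : 0 < b) (hy : |y| ≤ b) :
    Real.exp (l * y) ≤ Real.cosh (l * b) + (y / b) * Real.sinh (l * b) := by
  obtain ⟨h1, h2⟩ := abs_le.mp hy
  have hp : 0 ≤ (1 + y / b) / 2 := by
    have : -1 ≤ y / b := by rw [le_div_iff₀ hb]; linarith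
    linarith
  have hq : 0 ≤ (1 - y / b) / 2 := by
    have : y / b ≤ 1 := by rw [div_le_iff₀ hb]; linarith
    linarith
  have := convexOn_exp.2 (Set.mem_univ (l * b)) (Set.mem_univ (-(l * b))) hp hq (by ring)
  simp only [smul_eq_mul] at this
  have e : (1 + y / b) / 2 * (l * b) + (1 - y / b) / 2 * -(l * b) = l * y := by
    field_simp; ring
  rw [e] at this
  rw [Real.cosh_eq, Real.sinh_eq]
  linarith

variable {Ω : Type*} {m0 : MeasurableSpace Ω} (P : Measure Ω) [IsProbabilityMeasure P]

def dev (F : Filtration ℕ m0) (Y : ℕ → Ω → ℝ) (n : ℕ) (ω : Ω) : ℝ :=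
  ∑ i ∈ Finset.Icc 1 n, (Y i ω - (P[Y i | F (i - 1)]) ω)

lemma step (m : MeasurableSpace Ω) (hm : m ≤ m0) (W : Ω → ℝ) (hW : StronglyMeasurable[m] W)
    (hWb : ∃ C, ∀ᵐ ω ∂P, |W ω| ≤ C) (Y : Ω → ℝ) (hY : Measurable[m0] Y) (b : ℝ) (hb : 0 < b)
    (hYb : ∀ᵐ ω ∂P, |Y ω| ≤ b) (l : ℝ) :
    ∫ ω, Real.exp (l * (W ω + (Y ω - (P[Y | m]) ω))) ∂P ≤
      Real.exp (l ^ 2 * b ^ 2 / 2) * ∫ ω, Real.exp (l * W ω) ∂P := by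
  obtain ⟨C, hC⟩ := hWb
  set μ : Ω → ℝ := P[Y | m] with hμ
  have hμm : StronglyMeasurable[m] μ := stronglyMeasurable_condExp
  have hμb : ∀ᵐ ω ∂P, |μ ω| ≤ b := by
    have := ae_bdd_condExp_of_ae_bdd (m := m) (μ := P) (R := ⟨b, hb.le⟩) (f := Y) hYb
    exact this
  have hYi : Integrable Y P := Integrable.of_bound hY.aestronglyMeasurable b hYb
  let G : Ω → ℝ := fun ω => Real.exp (l * (W ω - μ ω))
  have hGm : StronglyMeasurable[m] G :=
    Real.continuous_exp.comp_stronglyMeasurable ((hW.sub hμm).const_mul l)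
  have hGb : ∀ᵐ ω ∂P, ‖G ω‖ ≤ Real.exp (|l| * (C + b)) := by
    filter_upwards [hC, hμb] with ω h1 h2
    rw [Real.norm_eq_abs, Real.abs_exp]
    apply Real.exp_le_exp.mpr
    refine (le_abs_self _).trans ?_
    rw [abs_mul]
    gcongr
    exact (abs_sub _ _).trans (add_le_add h1 h2)
  have hGi : Integrable G P :=
    Integrable.of_bound (hGm.mono hm).aestronglyMeasurable _ hGb
  have hGY : Integrable (G * Y) P :=
    hYi.bdd_mul (hGm.mono hm).aestronglyMeasurable hGb
  have hGμ : Integrable (G * μ) P :=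
    integrable_condExp.bdd_mul (hGm.mono hm).aestronglyMeasurable hGb
  have hex : ∫ ω, G ω * Y ω ∂P = ∫ ω, G ω * μ ω ∂P := by
    have h := condExp_mul_of_stronglyMeasurable_left (μ := P) hGm hGY hYi
    calc ∫ ω, G ω * Y ω ∂P = ∫ ω, (P[G * Y | m]) ω ∂P := (integral_condExp hm).symm
      _ = _ := integral_congr_ae h
  have hWi : Integrable (fun ω => Real.exp (l * W ω)) P := by
    refine Integrable.of_bound (C := Real.exp (|l| * C))
      (Real.continuous_exp.comp_stronglyMeasurable ((hW.mono hm).const_mul l)).aestronglyMeasurable ?_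
    filter_upwards [hC] with ω h1
    rw [Real.norm_eq_abs, Real.abs_exp]
    apply Real.exp_le_exp.mpr
    refine (le_abs_self _).trans ?_
    rw [abs_mul]
    gcongr
  have hlin : ∀ Z : Ω → ℝ, Integrable (G * Z) P →
      Integrable (fun ω => Real.cosh (l * b) * G ω + (Real.sinh (l * b) / b) * (G ω * Z ω)) P :=
    fun Z hZ => (hGi.const_mul _).add (hZ.const_mul _)
  calc ∫ ω, Real.exp (l * (W ω + (Y ω - μ ω))) ∂P
      ≤ ∫ ω, (Real.cosh (l * b) * G ω + (Real.sinh (l * b) / b) * (G ω * Y ω)) ∂P := by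
        apply integral_mono_of_nonneg (ae_of_all _ fun ω => (Real.exp_pos _).le) (hlin Y hGY)
        filter_upwards [hYb] with ω h
        have := mul_le_mul_of_nonneg_left (exp_chord (Y ω) l b hb h) (Real.exp_pos (l * (W ω - μ ω))).le
        rw [← Real.exp_add] at this
        convert this using 1
        · ring_nf
        · simp only [G]; ring
    _ = ∫ ω, (Real.cosh (l * b) * G ω + (Real.sinh (l * b) / b) * (G ω * μ ω)) ∂P := by
        have hGY' : Integrable (fun ω => G ω * Y ω) P := hGY
        have hGμ' : Integrable (fun ω => G ω * μ ω) P := hGμ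
        rw [integral_add (hGi.const_mul _) (hGY'.const_mul _),
          integral_add (hGi.const_mul _) (hGμ'.const_mul _), integral_const_mul,
          integral_const_mul, integral_const_mul, hex]
    _ ≤ ∫ ω, Real.exp (l ^ 2 * b ^ 2 / 2) * Real.exp (l * W ω) ∂P := by
        apply integral_mono_ae (hlin μ hGμ) (hWi.const_mul _)
        filter_upwards [hμb] with ω h
        have h1 : |μ ω / b| ≤ 1 := by
          rw [abs_div, abs_of_pos hb, div_le_one hb]; exact h
        have := mul_le_mul_of_nonneg_left (two_point (μ ω / b) (l * b) h1)
          (Real.exp_pos (l * (W ω - μ ω))).le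
        rw [← Real.exp_add] at this
        have e : l * (W ω - μ ω) + (l * b * (μ ω / b) + (l * b) ^ 2 / 2) =
            l ^ 2 * b ^ 2 / 2 + l * W ω := by field_simp; ring
        rw [e, Real.exp_add] at this
        refine le_trans (le_of_eq ?_) this
        simp only [G]; ring
    _ = _ := by rw [integral_const_mul]

lemma dev_meas (F : Filtration ℕ m0) (Y : ℕ → Ω → ℝ)
    (hY : ∀ t, 1 ≤ t → Measurable[F t] (Y t)) (n : ℕ) :
    StronglyMeasurable[F n] (dev P F Y n) := by
  unfold dev
  apply Finset.stronglyMeasurable_fun_sum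
  intro i hi
  rw [Finset.mem_Icc] at hi
  exact ((hY i hi.1).stronglyMeasurable.mono (F.mono hi.2)).sub
    (stronglyMeasurable_condExp.mono (F.mono (by omega)))

lemma dev_bdd (F : Filtration ℕ m0) (Y : ℕ → Ω → ℝ) (b : ℝ) (hb : 0 < b)
    (hYb : ∀ t, 1 ≤ t → ∀ᵐ ω ∂P, |Y t ω| ≤ b) (n : ℕ) :
    ∃ C, ∀ᵐ ω ∂P, |dev P F Y n ω| ≤ C := by
  induction n with
  | zero => exact ⟨0, ae_of_all _ fun ω => by simp [dev]⟩
  | succ n ih =>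
    obtain ⟨C, hC⟩ := ih
    refine ⟨C + (b + b), ?_⟩
    have := ae_bdd_condExp_of_ae_bdd (m := F n) (μ := P) (R := ⟨b, hb.le⟩) (f := Y (n+1))
      (hYb (n+1) (by omega))
    filter_upwards [hC, hYb (n+1) (by omega), this] with ω h1 h2 h3
    unfold dev at h1 ⊢
    rw [Finset.sum_Icc_succ_top (by omega)]
    refine (abs_add_le _ _).trans (add_le_add h1 ((abs_sub _ _).trans (add_le_add h2 h3)))

lemma dev_mgf (F : Filtration ℕ m0) (Y : ℕ → Ω → ℝ)
    (hY : ∀ t, 1 ≤ t → Measurable[F t] (Y t)) (b : ℝ) (hb : 0 < b)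
    (hYb : ∀ t, 1 ≤ t → ∀ᵐ ω ∂P, |Y t ω| ≤ b) (l : ℝ) (n : ℕ) :
    mgf (dev P F Y n) P l ≤ Real.exp (l ^ 2 * b ^ 2 / 2 * n) := by
  induction n with
  | zero => simp [dev, mgf]
  | succ n ih =>
    have h := step P (F n) (F.le n) _ (dev_meas P F Y hY n) (dev_bdd P F Y b hb hYb n) (Y (n+1))
      ((hY (n+1) (by omega)).mono (F.le _) le_rfl) b hb (hYb (n+1) (by omega)) l
    have e : mgf (dev P F Y (n+1)) P l =
        ∫ ω, Real.exp (l * (dev P F Y n ω + (Y (n+1) ω - (P[Y (n+1) | F n]) ω))) ∂P := by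
      unfold mgf dev
      simp_rw [Finset.sum_Icc_succ_top (show 1 ≤ n + 1 by omega)]
      rfl
    rw [e]
    refine h.trans ((mul_le_mul_of_nonneg_left ih (Real.exp_pos _).le).trans (le_of_eq ?_))
    rw [← Real.exp_add]; push_cast; ring_nf

lemma dev_tail (F : Filtration ℕ m0) (Y : ℕ → Ω → ℝ)
    (hY : ∀ t, 1 ≤ t → Measurable[F t] (Y t)) (b : ℝ) (hb : 0 < b)
    (hYb : ∀ t, 1 ≤ t → ∀ᵐ ω ∂P, |Y t ω| ≤ b) (a : ℝ) (ha : 0 < a) (n : ℕ) :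
    P {ω | n * (a * b) ≤ |dev P F Y n ω|} ≤ ENNReal.ofReal (2 * Real.exp (-(n * a ^ 2 / 2))) := by
  have hint : ∀ l, Integrable (fun ω => Real.exp (l * dev P F Y n ω)) P := by
    intro l
    obtain ⟨C, hC⟩ := dev_bdd P F Y b hb hYb n
    refine Integrable.of_bound (C := Real.exp (|l| * C))
      (Real.continuous_exp.comp_stronglyMeasurable
        (((dev_meas P F Y hY n).mono (F.le n)).const_mul l)).aestronglyMeasurable ?_
    filter_upwards [hC] with ω h1
    rw [Real.norm_eq_abs, Real.abs_exp]
    apply Real.exp_le_exp.mpr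
    refine (le_abs_self _).trans ?_
    rw [abs_mul]
    gcongr
  have hl : 0 ≤ a / b := by positivity
  have h1 := measure_ge_le_exp_mul_mgf (X := dev P F Y n) (μ := P) (n * (a * b)) hl (hint _)
  have h2 := measure_le_le_exp_mul_mgf (X := dev P F Y n) (μ := P) (-(n * (a * b)))
    (t := -(a / b)) (by linarith) (hint _)
  have k1 := dev_mgf P F Y hY b hb hYb (a / b) n
  have k2 := dev_mgf P F Y hY b hb hYb (-(a / b)) n
  have h1' := h1.trans (mul_le_mul_of_nonneg_left k1 (Real.exp_pos _).le)
  have h2' := h2.trans (mul_le_mul_of_nonneg_left k2 (Real.exp_pos _).le)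
  rw [← Real.exp_add] at h1' h2'
  have e1 : -(a / b) * (n * (a * b)) + (a / b) ^ 2 * b ^ 2 / 2 * n = -(n * a ^ 2 / 2) := by
    field_simp; ring
  have e2 : -(-(a / b)) * -(n * (a * b)) + (-(a / b)) ^ 2 * b ^ 2 / 2 * n = -(n * a ^ 2 / 2) := by
    field_simp; ring
  rw [e1] at h1'
  rw [e2] at h2'
  have hsub : {ω | n * (a * b) ≤ |dev P F Y n ω|} ⊆
      {ω | n * (a * b) ≤ dev P F Y n ω} ∪ {ω | dev P F Y n ω ≤ -(n * (a * b))} := by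
    intro ω hω
    simp only [Set.mem_setOf_eq, Set.mem_union] at hω ⊢
    rcases le_abs.mp hω with h | h
    · exact Or.inl h
    · right; linarith
  refine (measure_mono hsub).trans ((measure_union_le _ _).trans ?_)
  rw [two_mul, ENNReal.ofReal_add (Real.exp_pos _).le (Real.exp_pos _).le]
  refine add_le_add ?_ ?_
  · rw [← ofReal_measureReal]; exact ENNReal.ofReal_le_ofReal h1'
  · rw [← ofReal_measureReal]; exact ENNReal.ofReal_le_ofReal h2'

end Helpers

section Det

variable {ι : Type*} [Fintype ι] [DecidableEq ι]

lemma l1_nonneg (v : ι → ℝ) : 0 ≤ l1 v := Finset.sum_nonneg fun _ _ => abs_nonneg _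

lemma l1_pos (v : ι → ℝ) (h : v ≠ 0) : 0 < l1 v := by
  obtain ⟨j, hj⟩ := Function.ne_iff.mp h
  exact Finset.sum_pos' (fun _ _ => abs_nonneg _) ⟨j, Finset.mem_univ _, abs_pos.mpr hj⟩

lemma l1_split (S : Finset ι) (v : ι → ℝ) : l1 v = l1 (restr S v) + l1 (restr Sᶜ v) := by
  unfold l1 restr
  rw [← Finset.sum_add_distrib]
  refine Finset.sum_congr rfl fun j _ => ?_
  by_cases h : j ∈ S <;> simp [h]

lemma quad_bound (A : Matrix ι ι ℝ) (ε : ℝ) (h : ∀ i j, |A i j| ≤ ε) (v : ι → ℝ) :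
    |v ⬝ᵥ (A *ᵥ v)| ≤ ε * l1 v ^ 2 := by
  have e : v ⬝ᵥ (A *ᵥ v) = ∑ i, ∑ j, v i * (A i j * v j) := by
    simp [dotProduct, mulVec, Finset.mul_sum]
  have e2 : ε * l1 v ^ 2 = ∑ i, ∑ j, |v i| * (ε * |v j|) := by
    unfold l1
    rw [sq, Finset.sum_mul_sum, Finset.mul_sum]
    refine Finset.sum_congr rfl fun i _ => ?_
    rw [Finset.mul_sum]
    exact Finset.sum_congr rfl fun j _ => by ring
  rw [e, e2]
  refine (Finset.abs_sum_le_sum_abs _ _).trans (Finset.sum_le_sum fun i _ => ?_)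
  refine (Finset.abs_sum_le_sum_abs _ _).trans (Finset.sum_le_sum fun j _ => ?_)
  rw [abs_mul, abs_mul]
  gcongr
  exact h i j

lemma compat_elem (N : Matrix ι ι ℝ) (S : Finset ι) (B : ℝ) (hB : 0 < B) (h : B ≤ compat N S)
    (v : ι → ℝ) (h1 : l1 (restr Sᶜ v) ≤ 3 * l1 (restr S v)) (h2 : restr S v ≠ 0) :
    B ≤ (S.card : ℝ) * (v ⬝ᵥ (N *ᵥ v)) / l1 (restr S v) ^ 2 := by
  refine h.trans (csInf_le ?_ ⟨v, h1, h2, rfl⟩)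
  by_contra hb
  unfold compat at h
  rw [Real.sInf_of_not_bddBelow hb] at h
  linarith

lemma compat_nonempty (N : Matrix ι ι ℝ) (S : Finset ι) (h : 0 < compat N S) : S.Nonempty := by
  by_contra hS
  rw [Finset.not_nonempty_iff_eq_empty] at hS
  subst hS
  unfold compat at h
  have : {c : ℝ | ∃ v : ι → ℝ, l1 (restr ∅ᶜ v) ≤ 3 * l1 (restr ∅ v) ∧ restr ∅ v ≠ 0 ∧
    c = ((∅ : Finset ι).card : ℝ) * (v ⬝ᵥ (N *ᵥ v)) / l1 (restr ∅ v) ^ 2} = ∅ := by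
    ext c
    simp only [Set.mem_setOf_eq, Set.mem_empty_iff_false, iff_false]
    rintro ⟨v, -, h2, -⟩
    exact h2 (by ext j; simp [restr])
  rw [this] at h
  simp at h

lemma compat_det (M N : Matrix ι ι ℝ) (S : Finset ι) (hS : S.Nonempty) (B ε : ℝ) (hε : 0 ≤ ε)
    (hN : ∀ v : ι → ℝ, l1 (restr Sᶜ v) ≤ 3 * l1 (restr S v) → restr S v ≠ 0 →
      B ≤ (S.card : ℝ) * (v ⬝ᵥ (N *ᵥ v)) / l1 (restr S v) ^ 2)
    (hMN : ∀ i j, |M i j - N i j| ≤ ε) (hεB : 16 * ε * S.card ≤ B / 2) :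
    B / 2 ≤ compat M S := by
  unfold compat
  apply le_csInf
  · obtain ⟨j, hj⟩ := hS
    refine ⟨_, Pi.single j 1, ?_, ?_, rfl⟩
    · have : restr Sᶜ (Pi.single j (1:ℝ)) = 0 := by
        ext k
        by_cases hk : k = j
        · subst hk; simp [restr, hj]
        · simp [restr, hk]
      rw [this]
      have h0 : l1 (0 : ι → ℝ) = 0 := by simp [l1]
      rw [h0]
      have := l1_nonneg (restr S (Pi.single j (1:ℝ)))
      linarith
    · intro h
      have := congrFun h j
      simp [restr, hj] at this
  · rintro c ⟨v, h1, h2, rfl⟩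
    have hp := l1_pos _ h2
    have hN' := hN v h1 h2
    rw [le_div_iff₀ (by positivity)] at hN' ⊢
    have hq := quad_bound (M - N) ε (fun i j => by simpa using hMN i j) v
    rw [sub_mulVec, dotProduct_sub] at hq
    have hq' := (abs_le.mp hq).1
    have hl : l1 v ^ 2 ≤ 16 * l1 (restr S v) ^ 2 := by
      have : l1 v ≤ 4 * l1 (restr S v) := by rw [l1_split S v]; linarith
      calc l1 v ^ 2 ≤ (4 * l1 (restr S v)) ^ 2 := by
            gcongr
            exact l1_nonneg v
        _ = _ := by ring
    have h3 : ε * l1 v ^ 2 ≤ ε * (16 * l1 (restr S v) ^ 2) := by gcongr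
    have h4 : v ⬝ᵥ (N *ᵥ v) - ε * (16 * l1 (restr S v) ^ 2) ≤ v ⬝ᵥ (M *ᵥ v) := by linarith
    have h5 := mul_le_mul_of_nonneg_left h4 (Nat.cast_nonneg (α := ℝ) S.card)
    have h6 := mul_le_mul_of_nonneg_right hεB (sq_nonneg (l1 (restr S v)))
    nlinarith

end Det

lemma tail_sum (D δ a : ℝ) (hD : 0 < D) (hδ : 0 < δ) (ha : 0 < a) (T : ℝ)
    (hT : 2 / a ^ 2 * (Real.log (D / δ) + 2 * Real.log (2 / a)) + 1 ≤ T) :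
    D * (2 * Real.exp (-(T * a ^ 2 / 2))) * (1 - Real.exp (-(a ^ 2 / 2)))⁻¹ ≤ δ := by
  have hr : Real.exp (-(a ^ 2 / 2)) < 1 := by
    rw [Real.exp_lt_one_iff]; have : 0 < a ^ 2 := by positivity
    linarith
  have h1 : -(T * a ^ 2 / 2) ≤ -(Real.log (D / δ)) + (-(2 * Real.log (2 / a)) + -(a ^ 2 / 2)) := by
    have := mul_le_mul_of_nonneg_right hT (show 0 ≤ a ^ 2 / 2 by positivity)
    have e : (2 / a ^ 2 * (Real.log (D / δ) + 2 * Real.log (2 / a)) + 1) * (a ^ 2 / 2) =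
      Real.log (D / δ) + 2 * Real.log (2 / a) + a ^ 2 / 2 := by field_simp
    rw [e] at this
    linarith
  have h2 := Real.exp_le_exp.mpr h1
  have e1 : Real.exp (-(Real.log (D / δ))) = δ / D := by
    rw [Real.exp_neg, Real.exp_log (by positivity), inv_div]
  have e2 : Real.exp (-(2 * Real.log (2 / a))) = a ^ 2 / 4 := by
    rw [Real.exp_neg, two_mul, Real.exp_add, Real.exp_log (by positivity)]
    field_simp; norm_num
  rw [Real.exp_add, Real.exp_add, e1, e2] at h2
  rw [← div_eq_mul_inv, div_le_iff₀ (by linarith)]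
  set r := Real.exp (-(a ^ 2 / 2)) with hrdef
  have h3 : a ^ 2 / 2 * r ≤ 1 - r := by
    have := Real.add_one_le_exp (a ^ 2 / 2)
    have h4 : Real.exp (a ^ 2 / 2) * r = 1 := by rw [hrdef, ← Real.exp_add]; simp
    have := mul_le_mul_of_nonneg_right this (Real.exp_pos (-(a ^ 2 / 2))).le
    rw [← hrdef, h4] at this
    linarith
  calc D * (2 * Real.exp (-(T * a ^ 2 / 2))) ≤ D * (2 * (δ / D * (a ^ 2 / 4 * r))) := by gcongr
    _ = δ * (a ^ 2 / 2 * r) := by field_simp; ring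
    _ ≤ δ * (1 - r) := by gcongr

/-- **Time-uniform compatibility condition for empirical Gram matrices**: if the conditional
Gram matrices `V̄_t` satisfy `φ²(V̄_t, S₀) ≥ φ₀² t` for all `t ≥ 1`, then with probability at
least `1 − δ`, `φ²(V̂_t, S₀) ≥ φ₀² t / 2` simultaneously for all large enough `t`. -/
theorem compat_empirical_gram_uniform {Ω : Type*} {m0 : MeasurableSpace Ω} (P : Measure Ω)
    [IsProbabilityMeasure P] {d : ℕ} (F : Filtration ℕ m0) (x : ℕ → Ω → Fin d → ℝ)
    (hadapted : ∀ t, 1 ≤ t → Measurable[F t] (x t))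
    (xmax : ℝ) (hxmax : 0 < xmax)
    (hbdd : ∀ t, 1 ≤ t → ∀ᵐ ω ∂P, ∀ j, |x t ω j| ≤ xmax)
    (S0 : Finset (Fin d)) (φ0 : ℝ) (hφ0 : 0 < φ0)
    (hcompat : ∀ᵐ ω ∂P, ∀ t : ℕ, 1 ≤ t →
      compat (Matrix.of fun i j =>
          ∑ i' ∈ Finset.Icc 1 t, (P[fun ω' => x i' ω' i * x i' ω' j | F (i' - 1)]) ω) S0 ≥
        φ0 ^ 2 * t)
    (δ : ℝ) (hδ : 0 < δ) (hδ1 : δ ≤ 1) :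
    P {ω | ∀ t : ℕ,
        2048 * xmax ^ 4 * (S0.card : ℝ) ^ 2 / φ0 ^ 4 *
            (Real.log ((d : ℝ) ^ 2 / δ) + 2 * Real.log (64 * xmax ^ 2 * S0.card / φ0 ^ 2)) + 1 ≤
          (t : ℝ) →
        compat (Matrix.of fun i j => ∑ i' ∈ Finset.Icc 1 t, x i' ω i * x i' ω j) S0 ≥
          φ0 ^ 2 * t / 2} ≥
      ENNReal.ofReal (1 - δ) := by
  have hS : S0.Nonempty := by
    obtain ⟨ω, hω⟩ := hcompat.exists
    refine compat_nonempty _ S0 (lt_of_lt_of_le ?_ (hω 1 le_rfl))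
    positivity
  have hs : (0 : ℝ) < S0.card := by exact_mod_cast hS.card_pos
  have hd : (0 : ℝ) < d := by
    obtain ⟨j, _⟩ := hS
    exact_mod_cast j.pos
  set b : ℝ := xmax ^ 2 with hb
  set a : ℝ := φ0 ^ 2 / (32 * S0.card * xmax ^ 2) with ha
  have hb0 : 0 < b := by positivity
  have ha0 : 0 < a := by positivity
  have e1 : 2048 * xmax ^ 4 * (S0.card : ℝ) ^ 2 / φ0 ^ 4 = 2 / a ^ 2 := by
    rw [ha]; field_simp; norm_num
  have e2 : 64 * b * S0.card / φ0 ^ 2 = 2 / a := by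
    rw [ha, hb]; field_simp; norm_num
  rw [e1, e2]
  set T : ℝ := 2 / a ^ 2 * (Real.log ((d : ℝ) ^ 2 / δ) + 2 * Real.log (2 / a)) + 1 with hT
  let Y : Fin d → Fin d → ℕ → Ω → ℝ := fun i j t ω => x t ω i * x t ω j
  have hY : ∀ i j t, 1 ≤ t → Measurable[F t] (Y i j t) := fun i j t ht =>
    ((measurable_pi_apply i).comp (hadapted t ht)).mul
      ((measurable_pi_apply j).comp (hadapted t ht))
  have hYb : ∀ i j t, 1 ≤ t → ∀ᵐ ω ∂P, |Y i j t ω| ≤ b := by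
    intro i j t ht
    filter_upwards [hbdd t ht] with ω h
    simp only [Y, hb, abs_mul, sq]
    exact mul_le_mul (h i) (h j) (abs_nonneg _) hxmax.le
  set A := {ω | ∀ t : ℕ, T ≤ (t : ℝ) →
        compat (Matrix.of fun i j => ∑ i' ∈ Finset.Icc 1 t, x i' ω i * x i' ω j) S0 ≥
          φ0 ^ 2 * t / 2} with hA
  set n0 := ⌈T⌉₊ with hn0
  let Bad : ℕ → Set Ω := fun k => ⋃ i : Fin d, ⋃ j : Fin d,
    {ω | ((n0 + k : ℕ) : ℝ) * (a * b) ≤ |dev P F (Y i j) (n0 + k) ω|}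
  let r := Real.exp (-(a ^ 2 / 2))
  have hBad : ∀ k, P (Bad k) ≤
      ENNReal.ofReal ((d : ℝ) ^ 2 * (2 * Real.exp (-(n0 * a ^ 2 / 2))) * r ^ k) := by
    intro k
    have h0 : ∀ i j, P {ω | ((n0 + k : ℕ) : ℝ) * (a * b) ≤ |dev P F (Y i j) (n0 + k) ω|} ≤
        ENNReal.ofReal (2 * Real.exp (-(n0 * a ^ 2 / 2)) * r ^ k) := by
      intro i j
      refine (dev_tail P F (Y i j) (hY i j) b hb0 (hYb i j) a ha0 (n0 + k)).trans (le_of_eq ?_)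
      congr 1
      simp only [r]
      rw [← Real.exp_nat_mul, mul_assoc, ← Real.exp_add]
      push_cast
      ring_nf
    calc P (Bad k) ≤ ∑ i : Fin d, ∑ j : Fin d,
          P {ω | ((n0 + k : ℕ) : ℝ) * (a * b) ≤ |dev P F (Y i j) (n0 + k) ω|} := by
          refine (measure_iUnion_fintype_le _ _).trans (Finset.sum_le_sum fun i _ => ?_)
          exact measure_iUnion_fintype_le _ _
      _ ≤ ∑ i : Fin d, ∑ j : Fin d, ENNReal.ofReal (2 * Real.exp (-(n0 * a ^ 2 / 2)) * r ^ k) :=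
          Finset.sum_le_sum fun i _ => Finset.sum_le_sum fun j _ => h0 i j
      _ = _ := by
          simp only [Finset.sum_const, Finset.card_univ, Fintype.card_fin, nsmul_eq_mul]
          have e : (d : ℝ) ^ 2 * (2 * Real.exp (-(n0 * a ^ 2 / 2))) * r ^ k =
              d * (d * (2 * Real.exp (-(n0 * a ^ 2 / 2)) * r ^ k)) := by ring
          rw [e, ENNReal.ofReal_mul hd.le, ENNReal.ofReal_mul hd.le, ENNReal.ofReal_natCast]
  have hr1 : r < 1 := by
    simp only [r]
    rw [Real.exp_lt_one_iff]
    have : 0 < a ^ 2 := by positivity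
    linarith
  have hr0 : 0 ≤ r := (Real.exp_pos _).le
  have hUnion : P (⋃ k, Bad k) ≤ ENNReal.ofReal δ := by
    refine (measure_iUnion_le _).trans ((ENNReal.tsum_le_tsum hBad).trans ?_)
    rw [← ENNReal.ofReal_tsum_of_nonneg (fun k => by positivity)
      ((summable_geometric_of_lt_one hr0 hr1).mul_left _), tsum_mul_left,
      tsum_geometric_of_lt_one hr0 hr1]
    apply ENNReal.ofReal_le_ofReal
    exact tail_sum _ δ a (by positivity) hδ ha0 n0 (Nat.le_ceil T)
  have hAc : P Aᶜ ≤ ENNReal.ofReal δ := by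
    refine le_trans (measure_mono_ae ?_) hUnion
    filter_upwards [hcompat] with ω hω hωA
    by_contra hgood
    apply hωA
    intro t ht
    obtain ⟨k, rfl⟩ : ∃ k, t = n0 + k := Nat.exists_eq_add_of_le (Nat.ceil_le.mpr ht)
    have hg : ∀ i j, |dev P F (Y i j) (n0 + k) ω| ≤ ((n0 + k : ℕ) : ℝ) * (a * b) := by
      intro i j
      by_contra hlt
      exact hgood (Set.mem_iUnion.mpr ⟨k, Set.mem_iUnion.mpr ⟨i, Set.mem_iUnion.mpr
        ⟨j, (not_le.mp hlt).le⟩⟩⟩)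
    refine compat_det _ (Matrix.of fun i j =>
          ∑ i' ∈ Finset.Icc 1 (n0 + k), (P[fun ω' => x i' ω' i * x i' ω' j | F (i' - 1)]) ω)
      S0 hS _ (((n0 + k : ℕ) : ℝ) * (a * b)) (by positivity) ?_ ?_ ?_
    · intro v h1 h2
      rcases Nat.eq_zero_or_pos (n0 + k) with h0 | h0
      · rw [h0]
        have hz : (Matrix.of fun i j => ∑ i' ∈ Finset.Icc 1 0,
          (P[fun ω' => x i' ω' i * x i' ω' j | F (i' - 1)]) ω) = (0 : Matrix (Fin d) (Fin d) ℝ) := by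
          ext i j; simp
        rw [hz]
        simp
      · refine compat_elem _ S0 _ ?_ (hω _ h0) v h1 h2
        have : (0:ℝ) < ((n0 + k : ℕ) : ℝ) := by exact_mod_cast h0
        positivity
    · intro i j
      refine le_trans (le_of_eq ?_) (hg i j)
      simp only [Matrix.of_apply, dev, Y, Finset.sum_sub_distrib]
    · apply le_of_eq
      rw [ha, hb]; field_simp; push_cast; ring
  have hone : ENNReal.ofReal 1 ≤ P A + ENNReal.ofReal δ := by
    calc ENNReal.ofReal 1 = P Set.univ := by simp
      _ = P (A ∪ Aᶜ) := by rw [Set.union_compl_self]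
      _ ≤ P A + P Aᶜ := measure_union_le _ _
      _ ≤ _ := by gcongr
  rw [ge_iff_le, ENNReal.ofReal_sub _ hδ.le]
  exact tsub_le_iff_right.mpr hone

end Paper
end
end

section
/- Consider the sparse linear contextual bandit under the boundedness and α-margin assumptions. Fix M₀, n ∈ ℕ₀ and suppose that for every round i > M₀ + n the arm is chosen greedily, a_i = argmax_k x_{i,k}ᵀβ̂_{i−1}, where β̂_{i−1} is measurable with respect to F⁺_{i−1}, the σ-algebra generated by the context vectors, actions, and rewards of rounds 1,…,i−1. Let N_n(t') = Σ_{i=M₀+n+1}^{M₀+n+t'} 1{a_i ≠ a_i*}. Then for any δ ∈ (0,1], with probability at least 1 − δ, for all t' ≥ 0: N_n(t') ≤ (5/4)·Σ_{i=M₀+n+1}^{M₀+n+t'} min{1, ((2·x_max/Δ*)·‖β* − β̂_{i−1}‖₁)^α} + 4·log(1/δ). -/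
set_option autoImplicit false

open MeasureTheory ProbabilityTheory Matrix Finset
open scoped Classical ENNReal

noncomputable section

namespace Paper

def supp {d : ℕ} (β : Fin d → ℝ) : Finset (Fin d) := Finset.univ.filter fun j => β j ≠ 0

def gapOf {K d : ℕ} (βstar : Fin d → ℝ) (x : Fin K → Fin d → ℝ) (astar : Fin K) : ℝ :=
  x astar ⬝ᵥ βstar - ⨆ k : {k : Fin K // k ≠ astar}, x k.1 ⬝ᵥ βstar

variable {Ω : Type*}

def reward {d K : ℕ} (X : ℕ → Ω → Fin K → Fin d → ℝ) (act : ℕ → Ω → Fin K)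
    (βstar : Fin d → ℝ) (η : ℕ → Ω → ℝ) (t : ℕ) (ω : Ω) : ℝ :=
  X t ω (act t ω) ⬝ᵥ βstar + η t ω

def sigF [MeasurableSpace Ω] {d K : ℕ} (X : ℕ → Ω → Fin K → Fin d → ℝ)
    (act : ℕ → Ω → Fin K) (r : ℕ → Ω → ℝ) (t : ℕ) : MeasurableSpace Ω :=
  (⨆ i ∈ Finset.Icc 1 t, MeasurableSpace.comap (X i) inferInstance) ⊔
    (⨆ i ∈ Finset.Icc 1 t, MeasurableSpace.comap (act i) inferInstance) ⊔
    (⨆ i ∈ Finset.Icc 1 (t - 1), MeasurableSpace.comap (r i) inferInstance)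

def sigFplus [MeasurableSpace Ω] {d K : ℕ} (X : ℕ → Ω → Fin K → Fin d → ℝ)
    (act : ℕ → Ω → Fin K) (r : ℕ → Ω → ℝ) (t : ℕ) : MeasurableSpace Ω :=
  (⨆ i ∈ Finset.Icc 1 t, MeasurableSpace.comap (X i) inferInstance) ⊔
    (⨆ i ∈ Finset.Icc 1 t, MeasurableSpace.comap (act i) inferInstance) ⊔
    (⨆ i ∈ Finset.Icc 1 t, MeasurableSpace.comap (r i) inferInstance)

def regret {d K : ℕ} (X : ℕ → Ω → Fin K → Fin d → ℝ) (act astar : ℕ → Ω → Fin K)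
    (βstar : Fin d → ℝ) (t : ℕ) (ω : Ω) : ℝ :=
  X t ω (astar t ω) ⬝ᵥ βstar - X t ω (act t ω) ⬝ᵥ βstar

def avgGram [MeasurableSpace Ω] (P : Measure Ω) {d K : ℕ}
    (X : ℕ → Ω → Fin K → Fin d → ℝ) : Matrix (Fin d) (Fin d) ℝ :=
  Matrix.of fun i j => (K : ℝ)⁻¹ * ∫ ω, ∑ k, X 1 ω k i * X 1 ω k j ∂P

/-- The sparse linear contextual bandit model, under the boundedness, `α`-margin, and
compatibility-condition-on-the-optimal-arm assumptions. -/
structure Model (Ω : Type*) [MeasurableSpace Ω] (P : Measure Ω) (d K : ℕ) where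
  /-- the i.i.d. context tuples, round by round -/
  X : ℕ → Ω → Fin K → Fin d → ℝ
  /-- the noise sequence -/
  η : ℕ → Ω → ℝ
  /-- the actions chosen by the learner -/
  act : ℕ → Ω → Fin K
  /-- the optimal arms -/
  astar : ℕ → Ω → Fin K
  /-- the unknown parameter -/
  βstar : Fin d → ℝ
  /-- the sub-Gaussian parameter of the noise -/
  σ : ℝ
  /-- the bound on the sup norm of the contexts -/
  xmax : ℝ
  /-- the bound on the ℓ¹ norm of the parameter -/
  b : ℝ
  /-- the margin exponent -/
  α : ℝ
  /-- the margin constant -/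
  Δstar : ℝ
  /-- the compatibility constant of the optimal arm -/
  φstar : ℝ
  /-- the common law of the context tuples -/
  DX : Measure (Fin K → Fin d → ℝ)
  hK : 2 ≤ K
  probMeas : IsProbabilityMeasure P
  hσ : 0 < σ
  hxmax : 0 < xmax
  hb : 0 < b
  hα : 0 < α
  hΔstar : 0 < Δstar
  hφstar : 0 < φstar
  measX : ∀ t, Measurable (X t)
  measη : ∀ t, Measurable (η t)
  measAct : ∀ t, Measurable (act t)
  measAstar : ∀ t, Measurable (astar t)
  /-- the context tuples are identically distributed across rounds -/
  ident : ∀ t, 1 ≤ t → P.map (X t) = DX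
  /-- the round-`t` context tuple is independent of the past -/
  indepX : ∀ t, 1 ≤ t → Indep (MeasurableSpace.comap (X t) inferInstance)
      (sigFplus X act (reward X act βstar η) (t - 1)) P
  /-- the noise has a conditional moment generating function -/
  noiseInt : ∀ t, 1 ≤ t → ∀ s : ℝ, Integrable (fun ω => Real.exp (s * η t ω)) P
  /-- the noise is conditionally `σ`-sub-Gaussian -/
  subG : ∀ t, 1 ≤ t → ∀ s : ℝ, ∀ᵐ ω ∂P,
      (P[fun ω' => Real.exp (s * η t ω') | sigF X act (reward X act βstar η) t]) ω ≤
        Real.exp (s ^ 2 * σ ^ 2 / 2)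
  /-- boundedness of the contexts -/
  bddX : ∀ t, 1 ≤ t → ∀ᵐ ω ∂P, ∀ k j, |X t ω k j| ≤ xmax
  /-- boundedness of the parameter -/
  bddβ : l1 βstar ≤ b
  /-- nontrivial support -/
  suppNe : (supp βstar).Nonempty
  /-- `astar t` is the optimal arm in round `t` -/
  optAstar : ∀ t ω k, X t ω k ⬝ᵥ βstar ≤ X t ω (astar t ω) ⬝ᵥ βstar
  /-- the `α`-margin condition -/
  margin : ∀ t, 1 ≤ t → ∀ h : ℝ, 0 < h →
      P {ω | gapOf βstar (X t ω) (astar t ω) ≤ h} ≤ ENNReal.ofReal ((h / Δstar) ^ α)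
  /-- the compatibility condition on the optimal arm -/
  compatOpt : ∀ t, 1 ≤ t →
      compat (gram P fun ω => X t ω (astar t ω)) (supp βstar) ≥ φstar ^ 2

/-- The `FS-WLasso` algorithm run on the sparse linear contextual bandit model. -/
structure FSWLasso (Ω : Type*) [MeasurableSpace Ω] (P : Measure Ω) (d K : ℕ)
    extends Model Ω P d K where
  /-- the length of the forced-sampling stage -/
  M0 : ℕ
  /-- the weight between the two parts of the loss -/
  w : ℝ
  /-- the regularization parameters -/
  lam : ℕ → ℝ
  /-- `βhat t` is the weighted-loss Lasso estimator computed from the data of rounds `1..t` -/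
  βhat : ℕ → Ω → Fin d → ℝ
  hw : 0 ≤ w
  measβhat : ∀ t, Measurable[sigFplus X act (reward X act βstar η) t] (βhat t)
  /-- in the forced-sampling stage the arm is drawn uniformly at random -/
  unif : ∀ t, 1 ≤ t → t ≤ M0 → ∀ k, P {ω | act t ω = k} = (K : ℝ≥0∞)⁻¹
  /-- the forced-sampling randomization is independent of the current contexts and the past -/
  unifIndep : ∀ t, 1 ≤ t → t ≤ M0 →
      Indep (MeasurableSpace.comap (act t) inferInstance)
        (sigFplus X act (reward X act βstar η) (t - 1) ⊔
          MeasurableSpace.comap (X t) inferInstance) P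
  /-- `βhat t` minimizes the weighted squared-error Lasso objective over the data of
  rounds `1..t` -/
  lasso : ∀ t, M0 ≤ t → ∀ ω, ∀ β : Fin d → ℝ,
      w * ∑ i ∈ Finset.Icc 1 M0,
          (X i ω (act i ω) ⬝ᵥ βhat t ω - reward X act βstar η i ω) ^ 2 +
        ∑ i ∈ Finset.Icc (M0 + 1) t,
          (X i ω (act i ω) ⬝ᵥ βhat t ω - reward X act βstar η i ω) ^ 2 +
        lam t * l1 (βhat t ω) ≤
      w * ∑ i ∈ Finset.Icc 1 M0, (X i ω (act i ω) ⬝ᵥ β - reward X act βstar η i ω) ^ 2 +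
        ∑ i ∈ Finset.Icc (M0 + 1) t, (X i ω (act i ω) ⬝ᵥ β - reward X act βstar η i ω) ^ 2 +
        lam t * l1 β
  /-- in the greedy stage the learner chooses the arm maximizing the estimated reward -/
  greedy : ∀ t, M0 < t → ∀ ω k,
      X t ω k ⬝ᵥ βhat (t - 1) ω ≤ X t ω (act t ω) ⬝ᵥ βhat (t - 1) ω

/-- The (weighted) empirical Gram matrix `V̂_{M₀+n}`. -/
def Vhat [MeasurableSpace Ω] {P : Measure Ω} {d K : ℕ} (A : FSWLasso Ω P d K) (n : ℕ)
    (ω : Ω) : Matrix (Fin d) (Fin d) ℝ :=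
  Matrix.of fun i j =>
    A.w * ∑ t ∈ Finset.Icc 1 A.M0, A.X t ω (A.act t ω) i * A.X t ω (A.act t ω) j +
      ∑ t ∈ Finset.Icc (A.M0 + 1) (A.M0 + n), A.X t ω (A.act t ω) i * A.X t ω (A.act t ω) j


def gset {d K : ℕ} (β : Fin d → ℝ) : Set (ℝ × (Fin K → Fin d → ℝ)) :=
  {q | ∃ k l : Fin K, k ≠ l ∧ ∀ m, q.2 m ⬝ᵥ β ≤ q.2 k ⬝ᵥ β + q.1 ∧ q.2 m ⬝ᵥ β ≤ q.2 l ⬝ᵥ β + q.1}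

lemma measurable_dot {d K : ℕ} (β : Fin d → ℝ) (k : Fin K) :
    Measurable fun q : ℝ × (Fin K → Fin d → ℝ) => q.2 k ⬝ᵥ β := by
  unfold dotProduct
  fun_prop

lemma gset_meas {d K : ℕ} (β : Fin d → ℝ) : MeasurableSet (gset (K := K) β) := by
  have : gset (K := K) β = ⋃ k : Fin K, ⋃ l : Fin K, ⋃ _ : k ≠ l, ⋂ m : Fin K,
      ({q | q.2 m ⬝ᵥ β ≤ q.2 k ⬝ᵥ β + q.1} ∩ {q | q.2 m ⬝ᵥ β ≤ q.2 l ⬝ᵥ β + q.1}) := by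
    ext q; simp [gset]
  rw [this]
  refine MeasurableSet.iUnion fun k => MeasurableSet.iUnion fun l => MeasurableSet.iUnion fun _ =>
    MeasurableSet.iInter fun m => MeasurableSet.inter ?_ ?_
  · exact measurableSet_le (measurable_dot β m) ((measurable_dot β k).add measurable_fst)
  · exact measurableSet_le (measurable_dot β m) ((measurable_dot β l).add measurable_fst)

def pfun (c α h : ℝ) : ℝ := min 1 ((h / c) ^ α)

def yfun {d K : ℕ} (β : Fin d → ℝ) (c α : ℝ) (q : ℝ × (Fin K → Fin d → ℝ)) : ℝ≥0∞ :=
  ENNReal.ofReal (Real.exp (-(5 / 16 * pfun c α q.1))) *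
    (1 + ENNReal.ofReal (5 / 16) * (gset β).indicator 1 q)

lemma pfun_meas (c α : ℝ) : Measurable (pfun c α) := by
  unfold pfun; fun_prop

lemma yfun_meas {d K : ℕ} (β : Fin d → ℝ) (c α : ℝ) : Measurable (yfun (K := K) β c α) := by
  unfold yfun
  have h1 := pfun_meas c α
  have h2 : Measurable ((gset (K := K) β).indicator (1 : ℝ × (Fin K → Fin d → ℝ) → ℝ≥0∞)) :=
    measurable_one.indicator (gset_meas β)
  fun_prop

lemma pfun_nonneg {c α h : ℝ} (hc : 0 < c) (hh : 0 ≤ h) : 0 ≤ pfun c α h := by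
  unfold pfun; positivity

lemma yfun_int {d K : ℕ} (β : Fin d → ℝ) (c α : ℝ) (hc : 0 < c)
    (μ : Measure (Fin K → Fin d → ℝ)) [IsProbabilityMeasure μ] (h : ℝ) (hh : 0 ≤ h)
    (hμ : μ {x | (h, x) ∈ gset β} ≤ ENNReal.ofReal ((h / c) ^ α)) :
    ∫⁻ x, yfun β c α (h, x) ∂μ ≤ 1 := by
  have hp := pfun_nonneg (α := α) hc hh
  have hms : MeasurableSet {x | (h, x) ∈ gset (K := K) β} :=
    measurable_prodMk_left (gset_meas β)
  have hμ' : μ {x | (h, x) ∈ gset β} ≤ ENNReal.ofReal (pfun c α h) := by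
    unfold pfun
    rw [ENNReal.ofReal_min]
    exact le_min (by simpa using prob_le_one) hμ
  have hmi : Measurable ({x | (h, x) ∈ gset (K := K) β}.indicator
      (1 : (Fin K → Fin d → ℝ) → ℝ≥0∞)) := measurable_one.indicator hms
  have e : ∀ x, (gset (K := K) β).indicator (1 : ℝ × (Fin K → Fin d → ℝ) → ℝ≥0∞) (h, x)
      = {x | (h, x) ∈ gset (K := K) β}.indicator 1 x := by
    intro x; simp [Set.indicator]
  unfold yfun
  simp only [e]
  rw [lintegral_const_mul _ (by fun_prop), lintegral_add_left measurable_const,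
    lintegral_const_mul _ hmi, lintegral_indicator_one hms]
  simp only [lintegral_const, measure_univ, mul_one]
  calc _ ≤ ENNReal.ofReal (Real.exp (-(5 / 16 * pfun c α h))) *
        (1 + ENNReal.ofReal (5 / 16) * ENNReal.ofReal (pfun c α h)) := by gcongr
    _ = ENNReal.ofReal (Real.exp (-(5 / 16 * pfun c α h)) * (1 + 5 / 16 * pfun c α h)) := by
      rw [ENNReal.ofReal_mul (by positivity), ENNReal.ofReal_add (by positivity) (by positivity),
        ENNReal.ofReal_mul (by positivity)]
      simp
    _ ≤ 1 := by
      rw [ENNReal.ofReal_le_one]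
      have := Real.add_one_le_exp (5 / 16 * pfun c α h)
      calc _ ≤ Real.exp (-(5 / 16 * pfun c α h)) * Real.exp (5 / 16 * pfun c α h) := by
            gcongr; linarith
        _ = 1 := by rw [← Real.exp_add]; simp

lemma exp_quarter : Real.exp (1 / 4) ≤ 21 / 16 := by
  have h : Real.exp (1 / 4) ^ 4 = Real.exp 1 := by
    rw [← Real.exp_nat_mul]; norm_num
  have h1 := Real.exp_one_lt_d9
  by_contra! hc
  have : (21 / 16 : ℝ) ^ 4 < Real.exp (1 / 4) ^ 4 := by gcongr
  rw [h] at this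
  norm_num at this
  linarith

lemma yfun_ge {d K : ℕ} (β : Fin d → ℝ) (c α : ℝ) (q : ℝ × (Fin K → Fin d → ℝ)) (z : ℝ)
    (hz : z = 0 ∨ (z = 1 ∧ q ∈ gset β)) :
    ENNReal.ofReal (Real.exp (1 / 4 * z - 5 / 16 * pfun c α q.1)) ≤ yfun β c α q := by
  unfold yfun
  rw [sub_eq_neg_add, Real.exp_add, ENNReal.ofReal_mul (by positivity)]
  gcongr
  rcases hz with rfl | ⟨rfl, hq⟩
  · simp
  · rw [Set.indicator_of_mem hq, Pi.one_apply, mul_one, mul_one,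
      show (1 : ℝ≥0∞) = ENNReal.ofReal 1 from ENNReal.ofReal_one.symm,
      ← ENNReal.ofReal_add (by positivity) (by positivity)]
    apply ENNReal.ofReal_le_ofReal
    have := exp_quarter
    norm_num at this ⊢
    linarith

def Wp (L : ℝ≥0∞) (Y : ℕ → Ω → ℝ≥0∞) : ℕ → Ω → ℝ≥0∞
  | 0 => fun _ => 1
  | t + 1 => fun ω => Wp L Y t ω * (if L < Wp L Y t ω then 1 else Y t ω)

lemma Wp_lower (L : ℝ≥0∞) (Y : ℕ → Ω → ℝ≥0∞) (ω : Ω) (u : ℕ → ℝ)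
    (hu : ∀ j, ENNReal.ofReal (Real.exp (u j)) ≤ Y j ω) (t : ℕ) :
    L < Wp L Y t ω ∨ ENNReal.ofReal (Real.exp (∑ j ∈ Finset.range t, u j)) ≤ Wp L Y t ω := by
  induction t with
  | zero => right; simp [Wp]
  | succ t ih =>
    by_cases h : L < Wp L Y t ω
    · left; simpa [Wp, h] using h
    · right
      have ih := ih.resolve_left h
      rw [Finset.sum_range_succ, Real.exp_add, ENNReal.ofReal_mul (by positivity)]
      simp only [Wp, h, if_false]
      exact mul_le_mul' ih (hu t)

lemma Wp_mono (L : ℝ≥0∞) (Y : ℕ → Ω → ℝ≥0∞) : Monotone fun t => {ω | L < Wp L Y t ω} := by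
  apply monotone_nat_of_le_succ
  intro t ω h
  simp only [Set.mem_ofPred_eq] at h ⊢
  simpa [Wp, h] using h

lemma indep_step {E F : Type*} [MeasurableSpace E] [MeasurableSpace F] [MeasurableSpace Ω]
    (P : Measure Ω) [IsProbabilityMeasure P] (X : Ω → E) (Q : Ω → F) (hX : Measurable X)
    (hQ : Measurable Q) (h : IndepFun X Q P) (φ : F × E → ℝ≥0∞) (hφ : Measurable φ) (ψ : Ω → ℝ≥0∞)
    (hb : ∀ ω, ∫⁻ x, φ (Q ω, x) ∂(P.map X) ≤ ψ ω) :
    ∫⁻ ω, φ (Q ω, X ω) ∂P ≤ ∫⁻ ω, ψ ω ∂P := by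
  have h1 := h.symm.map_prod_eq_prod_map_map hQ.aemeasurable hX.aemeasurable
  have : IsProbabilityMeasure (P.map X) := Measure.isProbabilityMeasure_map hX.aemeasurable
  calc ∫⁻ ω, φ (Q ω, X ω) ∂P = ∫⁻ z, φ z ∂(P.map fun ω => (Q ω, X ω)) :=
        (lintegral_map hφ (hQ.prodMk hX)).symm
    _ = ∫⁻ q, ∫⁻ x, φ (q, x) ∂(P.map X) ∂(P.map Q) := by
        rw [h1, lintegral_prod _ hφ.aemeasurable]
    _ = ∫⁻ ω, ∫⁻ x, φ (Q ω, x) ∂(P.map X) ∂P := lintegral_map hφ.lintegral_prod_right' hQ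
    _ ≤ _ := lintegral_mono hb

lemma Wp_prob [MeasurableSpace Ω] (P : Measure Ω) [IsProbabilityMeasure P] {d K : ℕ}
    (β : Fin d → ℝ) (c α : ℝ) (hc : 0 < c)
    (m : ℕ → MeasurableSpace Ω) (hm : ∀ j, m j ≤ ‹MeasurableSpace Ω›) (hmono : Monotone m)
    (X : ℕ → Ω → Fin K → Fin d → ℝ) (hX : ∀ j, Measurable[m (j + 1)] (X j))
    (hind : ∀ j, Indep (MeasurableSpace.comap (X j) inferInstance) (m j) P)
    (H : ℕ → Ω → ℝ) (hH : ∀ j, Measurable[m j] (H j)) (hH0 : ∀ j ω, 0 ≤ H j ω)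
    (hμ : ∀ j h, 0 ≤ h → P.map (X j) {x | (h, x) ∈ gset β} ≤ ENNReal.ofReal ((h / c) ^ α))
    (δ : ℝ) (hδ : 0 < δ) :
    ∃ B : Set Ω, MeasurableSet B ∧ P B ≤ ENNReal.ofReal δ ∧
      B = ⋃ t, {ω | ENNReal.ofReal (1 / δ) <
        Wp (ENNReal.ofReal (1 / δ)) (fun j ω => yfun β c α (H j ω, X j ω)) t ω} := by
  set L := ENNReal.ofReal (1 / δ) with hL
  set Y : ℕ → Ω → ℝ≥0∞ := fun j ω => yfun β c α (H j ω, X j ω) with hY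
  have hWm : ∀ t, Measurable[m t] (Wp L Y t) := by
    intro t
    induction t with
    | zero => exact measurable_const
    | succ t ih =>
      have ih' : Measurable[m (t + 1)] (Wp L Y t) := ih.mono (hmono (Nat.le_succ t)) le_rfl
      have hY' : Measurable[m (t + 1)] (Y t) :=
        (yfun_meas β c α).comp
          (Measurable.prodMk ((hH t).mono (hmono (Nat.le_succ t)) le_rfl) (hX t))
      letI := m (t + 1)
      exact ih'.mul (Measurable.ite (measurableSet_lt measurable_const ih') measurable_const hY')
  have hWm' : ∀ t, Measurable (Wp L Y t) := fun t => (hWm t).mono (hm t) le_rfl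
  have hX' : ∀ j, Measurable (X j) := fun t => (hX t).mono (hm _) le_rfl
  have hH' : ∀ j, Measurable (H j) := fun t => (hH t).mono (hm _) le_rfl
  have hInt : ∀ t, ∫⁻ ω, Wp L Y t ω ∂P ≤ 1 := by
    intro t
    induction t with
    | zero => simp [Wp]
    | succ t ih =>
      refine le_trans ?_ ih
      have hQ : Measurable[m t] fun ω => (Wp L Y t ω, H t ω) := (hWm t).prodMk (hH t)
      have hi : IndepFun (X t) (fun ω => (Wp L Y t ω, H t ω)) P := by
        rw [IndepFun_iff_Indep]
        exact indep_of_indep_of_le_right (hind t) hQ.comap_le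
      have : IsProbabilityMeasure (P.map (X t)) :=
        Measure.isProbabilityMeasure_map (hX' t).aemeasurable
      refine indep_step P (X t) (fun ω => (Wp L Y t ω, H t ω)) (hX' t)
        (hQ.mono (hm t) le_rfl) hi
        (fun z => z.1.1 * (if L < z.1.1 then 1 else yfun β c α (z.1.2, z.2))) ?_ _ ?_
      · have := yfun_meas (K := K) β c α
        refine measurable_fst.fst.mul (Measurable.ite
          (measurableSet_lt measurable_const measurable_fst.fst) measurable_const ?_)
        exact this.comp (measurable_fst.snd.prodMk measurable_snd)
      · intro ω
        dsimp only
        by_cases h : L < Wp L Y t ω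
        · simp [h]
        · simp only [h, if_false]
          have hmy : Measurable fun x : Fin K → Fin d → ℝ => yfun β c α (H t ω, x) :=
            (yfun_meas β c α).comp measurable_prodMk_left
          rw [lintegral_const_mul _ hmy]
          exact mul_le_of_le_one_right' (yfun_int β c α hc _ _ (hH0 t ω) (hμ t _ (hH0 t ω)))
  refine ⟨_, MeasurableSet.iUnion fun t => measurableSet_lt measurable_const (hWm' t), ?_, rfl⟩
  rw [(Wp_mono L Y).measure_iUnion]
  refine iSup_le fun t => ?_
  have h1 := (mul_meas_ge_le_lintegral (μ := P) (hWm' t) L).trans (hInt t)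
  have h2 : P {ω | L < Wp L Y t ω} ≤ P {ω | L ≤ Wp L Y t ω} :=
    measure_mono fun ω (h : L < Wp L Y t ω) => show L ≤ Wp L Y t ω from h.le
  refine h2.trans ?_
  have h3 : ENNReal.ofReal δ * L = 1 := by
    rw [hL, ← ENNReal.ofReal_mul hδ.le, mul_one_div_cancel hδ.ne', ENNReal.ofReal_one]
  calc P {ω | L ≤ Wp L Y t ω} = ENNReal.ofReal δ * (L * P {ω | L ≤ Wp L Y t ω}) := by
        rw [← mul_assoc, h3, one_mul]
    _ ≤ ENNReal.ofReal δ * 1 := by gcongr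
    _ = _ := mul_one _

lemma gset_prob_pos [MeasurableSpace Ω] (P : Measure Ω) {d K : ℕ} (A : Model Ω P d K) (t : ℕ)
    (ht : 1 ≤ t) (h : ℝ) (hh : 0 < h) :
    P.map (A.X t) {x | (h, x) ∈ gset A.βstar} ≤ ENNReal.ofReal ((h / A.Δstar) ^ A.α) := by
  have hms : MeasurableSet {x | (h, x) ∈ gset (K := K) A.βstar} :=
    measurable_prodMk_left (gset_meas _)
  rw [Measure.map_apply (A.measX t) hms]
  refine (measure_mono ?_).trans (A.margin t ht h hh)
  rintro ω ⟨k, l, hkl, hm⟩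
  have key : ∀ k, k ≠ A.astar t ω →
      A.X t ω (A.astar t ω) ⬝ᵥ A.βstar ≤ A.X t ω k ⬝ᵥ A.βstar + h →
      gapOf A.βstar (A.X t ω) (A.astar t ω) ≤ h := by
    intro k hk hle
    unfold gapOf
    have := le_ciSup (f := fun k : {k : Fin K // k ≠ A.astar t ω} => A.X t ω k.1 ⬝ᵥ A.βstar)
      (Set.finite_range _).bddAbove ⟨k, hk⟩
    dsimp only at this
    linarith
  by_cases hk : k = A.astar t ω
  · exact key l (fun e => hkl (hk.trans e.symm)) (hm _).2
  · exact key k hk (hm _).1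

lemma gset_prob [MeasurableSpace Ω] (P : Measure Ω) {d K : ℕ} (A : Model Ω P d K) (t : ℕ)
    (ht : 1 ≤ t) (h : ℝ) (hh : 0 ≤ h) :
    P.map (A.X t) {x | (h, x) ∈ gset A.βstar} ≤ ENNReal.ofReal ((h / A.Δstar) ^ A.α) := by
  have hc : Continuous fun e : ℝ => ENNReal.ofReal ((e / A.Δstar) ^ A.α) :=
    ENNReal.continuous_ofReal.comp
      ((continuous_id.div_const _).rpow_const fun _ => Or.inr A.hα.le)
  have ht' : Filter.Tendsto (fun e : ℝ => ENNReal.ofReal ((e / A.Δstar) ^ A.α))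
      (nhdsWithin h (Set.Ioi h)) (nhds (ENNReal.ofReal ((h / A.Δstar) ^ A.α))) :=
    (hc.tendsto h).mono_left nhdsWithin_le_nhds
  refine ge_of_tendsto ht' ?_
  filter_upwards [self_mem_nhdsWithin] with e he
  have he : h < e := he
  refine le_trans (measure_mono ?_) (gset_prob_pos P A t ht e (hh.trans_lt he))
  rintro x ⟨k, l, hkl, hm⟩
  refine ⟨k, l, hkl, fun m => ⟨?_, ?_⟩⟩
  · have := (hm m).1; dsimp only at this ⊢; linarith
  · have := (hm m).2; dsimp only at this ⊢; linarith

lemma dot_le {d : ℕ} (u v : Fin d → ℝ) (c : ℝ) (h : ∀ j, |u j| ≤ c) :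
    u ⬝ᵥ v ≤ c * l1 v := by
  unfold dotProduct l1
  rw [Finset.mul_sum]
  refine Finset.sum_le_sum fun j _ => ?_
  calc u j * v j ≤ |u j * v j| := le_abs_self _
    _ = |u j| * |v j| := abs_mul _ _
    _ ≤ c * |v j| := by gcongr; exact h j

lemma sigFplus_mono [MeasurableSpace Ω] {d K : ℕ} (X : ℕ → Ω → Fin K → Fin d → ℝ)
    (act : ℕ → Ω → Fin K) (r : ℕ → Ω → ℝ) : Monotone (sigFplus X act r) := by
  intro s t hst
  have : Finset.Icc 1 s ⊆ Finset.Icc 1 t := Finset.Icc_subset_Icc_right hst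
  unfold sigFplus
  refine sup_le_sup (sup_le_sup ?_ ?_) ?_ <;> exact biSup_mono fun i hi => this hi

/-- **Lemma (high-probability bound on the number of sub-optimal greedy selections)**: in the
sparse linear contextual bandit with boundedness and `α`-margin assumptions, if the arms are
chosen greedily with respect to `F⁺`-measurable estimators from round `M₀ + n + 1` on, then with
probability at least `1 − δ`, simultaneously for all `t' ≥ 0`, the number of sub-optimal
selections among rounds `M₀+n+1, …, M₀+n+t'` is at most
`(5/4) Σᵢ min{1, ((2 x_max/Δ*) ‖β* − β̂_{i−1}‖₁)^α} + 4 log(1/δ)`. -/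
theorem suboptimal_selection_bound {Ω : Type*} [MeasurableSpace Ω] (P : Measure Ω)
    {d K : ℕ} (A : Model Ω P d K) (M0 n : ℕ)
    (βhat : ℕ → Ω → Fin d → ℝ)
    (hβhatmeas : ∀ i,
      Measurable[sigFplus A.X A.act (reward A.X A.act A.βstar A.η) i] (βhat i))
    (hgreedy : ∀ i, M0 + n < i → ∀ ω k,
      A.X i ω k ⬝ᵥ βhat (i - 1) ω ≤ A.X i ω (A.act i ω) ⬝ᵥ βhat (i - 1) ω)
    (δ : ℝ) (hδ : 0 < δ) (hδ1 : δ ≤ 1) :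
    P {ω | ∀ t' : ℕ,
        (∑ i ∈ Finset.Icc (M0 + n + 1) (M0 + n + t'),
            if A.act i ω ≠ A.astar i ω then (1 : ℝ) else 0) ≤
          5 / 4 * ∑ i ∈ Finset.Icc (M0 + n + 1) (M0 + n + t'),
              min 1 ((2 * A.xmax / A.Δstar * l1 (A.βstar - βhat (i - 1) ω)) ^ A.α) +
            4 * Real.log (1 / δ)} ≥
      ENNReal.ofReal (1 - δ) := by
  have := A.probMeas
  set N := M0 + n with hN
  set m := sigFplus A.X A.act (reward A.X A.act A.βstar A.η) with hmdef
  have hrew : ∀ t, Measurable (reward A.X A.act A.βstar A.η t) := by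
    intro t
    have h1 : Measurable fun ω => A.X t ω (A.act t ω) ⬝ᵥ A.βstar := by
      have e : (fun ω => A.X t ω (A.act t ω) ⬝ᵥ A.βstar) =
          fun ω => ∑ k, if A.act t ω = k then A.X t ω k ⬝ᵥ A.βstar else 0 := by
        funext ω; simp
      rw [e]
      refine Finset.measurable_sum _ fun k _ => Measurable.ite
        (A.measAct t (measurableSet_singleton k)) ?_ measurable_const
      have hX := A.measX t
      unfold dotProduct
      fun_prop
    exact h1.add (A.measη t)
  have hm : ∀ j, m j ≤ ‹MeasurableSpace Ω› := by
    intro j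
    refine sup_le (sup_le ?_ ?_) ?_
    · exact iSup₂_le fun i _ => (A.measX i).comap_le
    · exact iSup₂_le fun i _ => (A.measAct i).comap_le
    · exact iSup₂_le fun i _ => (hrew i).comap_le
  have hmono : Monotone m := sigFplus_mono _ _ _
  have hXm : ∀ t, 1 ≤ t → Measurable[m t] (A.X t) := by
    intro t ht
    rw [measurable_iff_comap_le]
    refine le_trans ?_ (le_sup_left.trans le_sup_left)
    exact le_iSup₂_of_le t (Finset.mem_Icc.2 ⟨ht, le_rfl⟩) le_rfl
  have hl1 : ∀ v : Fin d → ℝ, 0 ≤ l1 v := fun v => Finset.sum_nonneg fun _ _ => abs_nonneg _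
  have hxm := A.hxmax
  set H : ℕ → Ω → ℝ := fun j ω => 2 * A.xmax * l1 (A.βstar - βhat (N + j) ω) with hHdef
  have hH0 : ∀ j ω, 0 ≤ H j ω := fun j ω => mul_nonneg (by positivity) (hl1 _)
  obtain ⟨B, hBm, hBP, hBe⟩ := Wp_prob P A.βstar A.Δstar A.α A.hΔstar (fun j => m (N + j))
    (fun j => hm _) (fun a b hab => hmono (by omega)) (fun j => A.X (N + j + 1))
    (fun j => hXm (N + j + 1) (by omega))
    (fun j => A.indepX (N + j + 1) (by omega)) H
    (by
      intro j
      have h1 := hβhatmeas (N + j)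
      have h2 : Measurable fun v : Fin d → ℝ => 2 * A.xmax * l1 (A.βstar - v) := by
        unfold l1
        simp only [Pi.sub_apply]
        have : ∀ k, Measurable fun v : Fin d → ℝ => |A.βstar k - v k| := by
          intro k
          exact (continuous_abs.comp (continuous_const.sub (continuous_apply k))).measurable
        exact (Finset.measurable_sum _ fun k _ => this k).const_mul _
      exact h2.comp h1)
    hH0 (fun j h hh => gset_prob P A _ (by omega) h hh) δ hδ
  have hb : ∀ᵐ ω ∂P, ∀ j : ℕ, ∀ k i, |A.X (N + j + 1) ω k i| ≤ A.xmax :=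
    ae_all_iff.2 fun j => A.bddX _ (by omega)
  have hcompl : ENNReal.ofReal (1 - δ) ≤ P Bᶜ := by
    rw [prob_compl_eq_one_sub hBm, ENNReal.ofReal_sub _ hδ.le, ENNReal.ofReal_one]
    exact tsub_le_tsub_left hBP 1
  refine ge_iff_le.2 (hcompl.trans (measure_mono_ae ?_))
  filter_upwards [hb] with ω hω hωB t
  have hωB : ω ∉ B := hωB
  rw [hBe] at hωB
  simp only [Set.mem_iUnion, Set.mem_ofPred_eq, not_exists, not_lt] at hωB
  set u : ℕ → ℝ := fun j => 1 / 4 * (if A.act (N + j + 1) ω ≠ A.astar (N + j + 1) ω then (1 : ℝ)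
    else 0) - 5 / 16 * pfun A.Δstar A.α (H j ω) with hu
  have hlow := Wp_lower (ENNReal.ofReal (1 / δ))
    (fun j ω => yfun A.βstar A.Δstar A.α (H j ω, A.X (N + j + 1) ω)) ω u (by
      intro j
      apply yfun_ge (q := (H j ω, A.X (N + j + 1) ω))
      by_cases hne : A.act (N + j + 1) ω ≠ A.astar (N + j + 1) ω
      · right
        refine ⟨if_pos hne, A.act (N + j + 1) ω, A.astar (N + j + 1) ω, hne, fun k => ?_⟩
        have h1 := A.optAstar (N + j + 1) ω k
        have h2 := hgreedy (N + j + 1) (by omega) ω (A.astar (N + j + 1) ω)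
        have h3 := hH0 j ω
        rw [Nat.add_sub_cancel] at h2
        have h4 := dot_le (A.X (N + j + 1) ω (A.astar (N + j + 1) ω) -
          A.X (N + j + 1) ω (A.act (N + j + 1) ω)) (A.βstar - βhat (N + j) ω) (2 * A.xmax) (by
            intro i
            have a1 := abs_le.1 (hω j (A.astar (N + j + 1) ω) i)
            have a2 := abs_le.1 (hω j (A.act (N + j + 1) ω) i)
            rw [Pi.sub_apply, abs_le]
            constructor <;> linarith)
        rw [sub_dotProduct, dotProduct_sub, dotProduct_sub] at h4
        dsimp only [hHdef] at h3 ⊢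
        constructor <;> linarith
      · left; exact if_neg hne) t
  have hle := hlow.resolve_left (not_lt.2 (hωB t)) |>.trans (hωB t)
  rw [ENNReal.ofReal_le_ofReal_iff (by positivity), ← Real.le_log_iff_exp_le (by positivity)] at hle
  have hs : ∀ f : ℕ → ℝ, ∑ i ∈ Finset.Icc (N + 1) (N + t), f i
      = ∑ j ∈ Finset.range t, f (N + j + 1) := by
    intro f
    have : Finset.Icc (N + 1) (N + t) = Finset.Ico (N + 1) (N + t + 1) := by
      ext; simp only [Finset.mem_Icc, Finset.mem_Ico]; omega
    rw [this, Finset.sum_Ico_eq_sum_range]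
    have : N + t + 1 - (N + 1) = t := by omega
    rw [this]
    exact Finset.sum_congr rfl fun j _ => by congr 1; ring
  show _ ≤ _
  rw [hs, hs]
  have hp : ∀ j, min 1 ((2 * A.xmax / A.Δstar * l1 (A.βstar - βhat (N + j + 1 - 1) ω)) ^ A.α)
      = pfun A.Δstar A.α (H j ω) := by
    intro j
    rw [Nat.add_sub_cancel]
    unfold pfun
    congr 2
    simp only [hHdef]
    ring
  simp only [hp]
  simp only [hu, Finset.sum_sub_distrib, ← Finset.mul_sum] at hle
  linarith

end Paper
end
end
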